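/- arXiv:2004.03648 — 4 statements merged into one kernel-verified Lean document; each statement's English description precedes it below -/
import Mathlib

section
/- Fix a step size Δ > 0 and let Q_Δ be the infinite midrise uniform quantizer Q_Δ(x) = Δ·⌊x/Δ⌋ + Δ/2. For every fixed real number y, the pushforward of the uniform probability measure on [−Δ/2, Δ/2) under the map d ↦ Q_Δ(y + d) − (y + d) equals the uniform probability measure on (−Δ/2, Δ/2]. In particular, the distribution of the quantization error of a uniformly dithered input does not depend on the input y. -/
open MeasureTheory

/-- The infinite midrise uniform quantizer with step size `Δ`. -/
noncomputable def midriseQuantizer (Δ x : ℝ) : ℝ := Δ * ⌊x / Δ⌋ + Δ / 2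

/-- The uniform probability measure on a set `s ⊆ ℝ`:
`(volume s)⁻¹` times Lebesgue measure restricted to `s`. -/
noncomputable def uniformOnSet (s : Set ℝ) : Measure ℝ :=
  (volume s)⁻¹ • volume.restrict s

theorem measurable_midriseQuantizer (Δ : ℝ) : Measurable (midriseQuantizer Δ) := by
  have h : Measurable fun x : ℝ => ((⌊x / Δ⌋ : ℤ) : ℝ) :=
    (measurable_from_top (f := fun n : ℤ => (n : ℝ))).comp
      (Int.measurable_floor.comp (measurable_id.div_const Δ))
  exact (h.const_mul Δ).add_const (Δ / 2)

theorem midriseQuantizer_zsmul_add {Δ : ℝ} (hΔ : Δ ≠ 0) (n : ℤ) (x : ℝ) :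
    midriseQuantizer Δ (n • Δ + x) = n • Δ + midriseQuantizer Δ x := by
  have h : (n • Δ + x) / Δ = x / Δ + n := by
    rw [zsmul_eq_mul]
    field_simp
    ring
  rw [midriseQuantizer, midriseQuantizer, h, Int.floor_add_intCast, zsmul_eq_mul]
  push_cast
  ring

theorem midriseQuantizer_of_mem_Ico {Δ x : ℝ} (hx : x ∈ Set.Ico 0 Δ) :
    midriseQuantizer Δ x = Δ / 2 := by
  have hΔ : 0 < Δ := hx.1.trans_lt hx.2
  have h : ⌊x / Δ⌋ = 0 :=
    Int.floor_eq_zero_iff.2 ⟨div_nonneg hx.1 hΔ.le, (div_lt_one hΔ).2 hx.2⟩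
  simp [midriseQuantizer, h]

/-- A set invariant under translation by multiples of `T` meets any two half-open intervals of
length `T` in sets of equal Lebesgue measure. -/
theorem volume_inter_Ico_eq_of_periodic {T : ℝ} (hT : 0 < T) {A : Set ℝ} (hA : MeasurableSet A)
    (hper : ∀ (n : ℤ) (x : ℝ), n • T + x ∈ A ↔ x ∈ A) (s t : ℝ) :
    volume (A ∩ Set.Ico s (s + T)) = volume (A ∩ Set.Ico t (t + T)) := by
  have hIoc (a : ℝ) : volume (A ∩ Set.Ico a (a + T)) = volume (A ∩ Set.Ioc a (a + T)) :=
    measure_congr ((ae_eq_refl A).inter Ico_ae_eq_Ioc)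
  rw [hIoc, hIoc]
  refine (isAddFundamentalDomain_Ioc hT s).measure_set_eq (isAddFundamentalDomain_Ioc hT t) hA ?_
  rintro ⟨_, n, rfl⟩
  ext x
  exact hper n x

/-- The quantization error maps Lebesgue measure on any half-open interval of length `Δ` to
Lebesgue measure on `(-Δ/2, Δ/2]`. -/
theorem map_quantizationError_restrict_Ico {Δ : ℝ} (hΔ : 0 < Δ) (y a : ℝ) :
    Measure.map (fun d => midriseQuantizer Δ (y + d) - (y + d))
        (volume.restrict (Set.Ico a (a + Δ)))
      = volume.restrict (Set.Ioc (-(Δ / 2)) (Δ / 2)) := by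
  have hmeas : Measurable fun d => midriseQuantizer Δ (y + d) - (y + d) :=
    ((measurable_midriseQuantizer Δ).comp (measurable_const_add y)).sub (measurable_const_add y)
  ext A hA
  rw [Measure.map_apply hmeas hA, Measure.restrict_apply (hmeas hA), Measure.restrict_apply hA,
    volume_inter_Ico_eq_of_periodic hΔ (hmeas hA) (t := -y)]
  · rw [← (Measure.measurePreserving_sub_left volume (Δ / 2 - y)).measure_preimage
      (hA.inter measurableSet_Ioc).nullMeasurableSet]
    congr 1
    ext d
    have hmem : d ∈ Set.Ico (-y) (-y + Δ) ↔ Δ / 2 - y - d ∈ Set.Ioc (-(Δ / 2)) (Δ / 2) := by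
      simp only [Set.mem_Ico, Set.mem_Ioc]
      constructor <;> rintro ⟨h₁, h₂⟩ <;> constructor <;> linarith
    simp only [Set.mem_inter_iff, Set.mem_preimage, ← hmem]
    refine and_congr_left fun hd => ?_
    rw [midriseQuantizer_of_mem_Ico ⟨by linarith [hd.1], by linarith [hd.2]⟩, sub_sub]
  · intro n x
    simp only [Set.mem_preimage]
    rw [add_left_comm y, midriseQuantizer_zsmul_add hΔ.ne', add_sub_add_left_eq_sub]

/-- For every fixed input `y`, the pushforward of the uniform measure on `[-Δ/2, Δ/2)` under
the subtractive-dither quantization-error map `d ↦ Q_Δ(y + d) - (y + d)` is the uniform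
measure on `(-Δ/2, Δ/2]`. -/
theorem quantizationError_dither_pushforward (Δ : ℝ) (hΔ : 0 < Δ) (y : ℝ) :
    Measure.map (fun d => midriseQuantizer Δ (y + d) - (y + d))
        (uniformOnSet (Set.Ico (-(Δ / 2)) (Δ / 2)))
      = uniformOnSet (Set.Ioc (-(Δ / 2)) (Δ / 2)) := by
  have hmap := map_quantizationError_restrict_Ico hΔ y (-(Δ / 2))
  rw [show -(Δ / 2) + Δ = Δ / 2 by ring] at hmap
  rw [uniformOnSet, uniformOnSet, Measure.map_smul, hmap, Real.volume_Ico, Real.volume_Ioc]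
end

section
/- Let Δ > 0 and let Q_Δ be the infinite midrise uniform quantizer with step size Δ. Let Y and D be real random variables on a probability space such that D is uniformly distributed on [−Δ/2, Δ/2) and D is independent of Y. Define the quantization error E = Q_Δ(Y + D) − (Y + D). Then E is uniformly distributed on (−Δ/2, Δ/2] and E is independent of Y. -/
open MeasureTheory ProbabilityTheory

/-- The error `Q_Δ(x) - x` of the midrise quantizer at the input `x`. -/
noncomputable def midriseError (Δ x : ℝ) : ℝ := midriseQuantizer Δ x - x

@[fun_prop]
lemma measurable_midriseError (Δ : ℝ) : Measurable (midriseError Δ) := by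
  unfold midriseError midriseQuantizer
  fun_prop

lemma midriseError_periodic {Δ : ℝ} (hΔ : Δ ≠ 0) : Function.Periodic (midriseError Δ) Δ := by
  intro x
  simp only [midriseError, midriseQuantizer, add_div, div_self hΔ, Int.floor_add_one]
  push_cast
  ring

lemma midriseError_of_mem_Ico {Δ x : ℝ} (hΔ : 0 < Δ) (hx : x ∈ Set.Ico 0 Δ) :
    midriseError Δ x = Δ / 2 - x := by
  have hfloor : ⌊x / Δ⌋ = 0 := by
    rw [Int.floor_eq_zero_iff]
    exact ⟨div_nonneg hx.1 hΔ.le, (div_lt_one hΔ).2 hx.2⟩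
  simp [midriseError, midriseQuantizer, hfloor]

/-- A function of period `T` pushes Lebesgue measure on any two half-open intervals of length `T`
to the same measure. -/
lemma Function.Periodic.map_restrict_Ico {α : Type*} [MeasurableSpace α] {f : ℝ → α} {T : ℝ}
    (hf : Function.Periodic f T) (hfm : Measurable f) (hT : 0 < T) (a b : ℝ) :
    (volume.restrict (Set.Ico a (a + T))).map f = (volume.restrict (Set.Ico b (b + T))).map f := by
  rw [restrict_Ico_eq_restrict_Ioc, restrict_Ico_eq_restrict_Ioc]
  ext s hs
  rw [Measure.map_apply hfm hs, Measure.map_apply hfm hs, Measure.restrict_apply (hfm hs),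
    Measure.restrict_apply (hfm hs)]
  refine (isAddFundamentalDomain_Ioc hT a).measure_set_eq (isAddFundamentalDomain_Ioc hT b)
    (hfm hs) ?_
  rintro ⟨_, n, rfl⟩
  ext x
  have hx : f (n • T + x) = f x := by rw [add_comm]; exact hf.zsmul n x
  simp [AddSubgroup.vadd_def, vadd_eq_add, -zsmul_eq_mul, hx]

lemma map_midriseError_add_uniformOnSet {Δ : ℝ} (hΔ : 0 < Δ) (y : ℝ) :
    (uniformOnSet (Set.Ico (-(Δ / 2)) (Δ / 2))).map (fun d ↦ midriseError Δ (y + d)) =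
      uniformOnSet (Set.Ioc (-(Δ / 2)) (Δ / 2)) := by
  have hshift : (volume.restrict (Set.Ico (-(Δ / 2)) (Δ / 2))).map (y + ·) =
      volume.restrict (Set.Ico (y - Δ / 2) (y - Δ / 2 + Δ)) := by
    have h := ((measurePreserving_add_left volume y).restrict_preimage
      (measurableSet_Ico (a := y - Δ / 2) (b := y - Δ / 2 + Δ))).map_eq
    rwa [Set.preimage_const_add_Ico, show y - Δ / 2 - y = -(Δ / 2) by ring,
      show y - Δ / 2 + Δ - y = Δ / 2 by ring] at h
  have hreflect : (volume.restrict (Set.Ico 0 Δ)).map (fun x ↦ Δ / 2 - x) =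
      volume.restrict (Set.Ioc (-(Δ / 2)) (Δ / 2)) := by
    have h := ((volume.measurePreserving_sub_left (Δ / 2)).restrict_preimage
      (measurableSet_Ioc (a := -(Δ / 2)) (b := Δ / 2))).map_eq
    rwa [Set.preimage_const_sub_Ioc, sub_self, sub_neg_eq_add, add_halves] at h
  have herror : (volume.restrict (Set.Ico 0 Δ)).map (midriseError Δ) =
      (volume.restrict (Set.Ico 0 Δ)).map (fun x ↦ Δ / 2 - x) :=
    Measure.map_congr <| (ae_restrict_mem measurableSet_Ico).mono
      fun _ ↦ midriseError_of_mem_Ico hΔ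
  have hperiod := (midriseError_periodic hΔ.ne').map_restrict_Ico (measurable_midriseError Δ) hΔ
    (y - Δ / 2) 0
  rw [zero_add] at hperiod
  rw [uniformOnSet, uniformOnSet, Measure.map_smul, Real.volume_Ico, Real.volume_Ioc, ← hreflect,
    ← herror, ← hperiod, ← hshift, Measure.map_map (by fun_prop) (by fun_prop)]
  rfl

/-- Subtractive dithered quantization: if the dither `D` is uniform on `[-Δ/2, Δ/2)` and
independent of the signal `Y`, then the quantization error `E = Q_Δ(Y + D) - (Y + D)` is
uniform on `(-Δ/2, Δ/2]` and independent of `Y`. -/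
theorem quantizationError_uniform_and_indep
    {Ω : Type*} [MeasurableSpace Ω] (P : Measure Ω) [IsProbabilityMeasure P]
    (Δ : ℝ) (hΔ : 0 < Δ) (Y D : Ω → ℝ) (hY : Measurable Y) (hD : Measurable D)
    (hDlaw : P.map D = uniformOnSet (Set.Ico (-(Δ / 2)) (Δ / 2)))
    (hindep : IndepFun D Y P)
    (E : Ω → ℝ) (hE : ∀ ω, E ω = midriseQuantizer Δ (Y ω + D ω) - (Y ω + D ω)) :
    P.map E = uniformOnSet (Set.Ioc (-(Δ / 2)) (Δ / 2)) ∧ IndepFun E Y P := by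
  obtain rfl : E = fun ω ↦ midriseError Δ (Y ω + D ω) := funext hE
  have : IsProbabilityMeasure (P.map Y) := Measure.isProbabilityMeasure_map hY.aemeasurable
  have : IsProbabilityMeasure (P.map D) := Measure.isProbabilityMeasure_map hD.aemeasurable
  have : SFinite (uniformOnSet (Set.Ioc (-(Δ / 2)) (Δ / 2))) := by
    unfold uniformOnSet; infer_instance
  have hpush := (MeasurePreserving.id (P.map Y)).skew_product (μc := P.map D)
    (g := fun y d ↦ midriseError Δ (y + d)) (by unfold Function.uncurry; fun_prop)
    (ae_of_all _ fun y ↦ by rw [hDlaw]; exact map_midriseError_add_uniformOnSet hΔ y)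
  have hprod := (indepFun_iff_map_prod_eq_prod_map_map hY.aemeasurable hD.aemeasurable).1
    hindep.symm
  have hjoint : P.map (fun ω ↦ (Y ω, midriseError Δ (Y ω + D ω))) =
      (P.map Y).prod (uniformOnSet (Set.Ioc (-(Δ / 2)) (Δ / 2))) := by
    rw [← hpush.map_eq, ← hprod, Measure.map_map hpush.measurable (by fun_prop)]
    rfl
  have hlaw : P.map (fun ω ↦ midriseError Δ (Y ω + D ω)) =
      uniformOnSet (Set.Ioc (-(Δ / 2)) (Δ / 2)) := by
    have h := congrArg Measure.snd hjoint
    rwa [Measure.snd_map_prodMk hY, Measure.snd_prod] at h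
  refine ⟨hlaw, IndepFun.symm ?_⟩
  rw [indepFun_iff_map_prod_eq_prod_map_map hY.aemeasurable (by fun_prop), hlaw, hjoint]
end

section
/- Let X be a random vector in ℝⁿ with law N(μ, Σ) and V a random vector in ℝᵐ with law N(0, R), where Σ and R are positive semidefinite, and suppose X and V are independent. Let C be a real m×n matrix and define the measurement Z = C·X + V. Assume the innovation covariance S = C·Σ·Cᵀ + R is invertible, and set the gain L = Σ·Cᵀ·S⁻¹. Then the matrix Σ − L·C·Σ is positive semidefinite, and for (law of Z)-almost every z ∈ ℝᵐ, the conditional distribution of X given Z = z is the Gaussian measure N(μ + L·(z − C·μ), Σ − L·C·Σ). -/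
open MeasureTheory ProbabilityTheory Matrix

/-- `IsGaussianVec ν m S` says that `ν` is the multivariate Gaussian measure `N(m, S)` on `ℝⁿ`,
characterized (Cramér–Wold) by every one-dimensional linear projection `x ↦ a ⬝ᵥ x` being
Gaussian with mean `a ⬝ᵥ m` and variance `aᵀ S a`. -/
def IsGaussianVec {n : ℕ} (ν : Measure (Fin n → ℝ)) (m : Fin n → ℝ)
    (S : Matrix (Fin n) (Fin n) ℝ) : Prop :=
  ∀ a : Fin n → ℝ,
    ν.map (fun x => a ⬝ᵥ x) = gaussianReal (a ⬝ᵥ m) (Real.toNNReal (a ⬝ᵥ S.mulVec a))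

namespace KalmanUpdate

/-- Every continuous linear functional on `ℝᵏ` is a dot product. -/
lemma exists_dotProduct_of_strongDual {k : ℕ} (f : StrongDual ℝ (Fin k → ℝ)) :
    ∃ u : Fin k → ℝ, ∀ x, f x = u ⬝ᵥ x := by
  refine ⟨fun i => f (Pi.single i 1), fun x => ?_⟩
  conv_lhs => rw [pi_eq_sum_univ' x]
  simp only [map_sum, map_smul, dotProduct, smul_eq_mul]
  refine Finset.sum_congr rfl fun i _ => ?_
  rw [mul_comm]

lemma quadForm_nonneg {k : ℕ} {S : Matrix (Fin k) (Fin k) ℝ} (hS : S.PosSemidef)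
    (u : Fin k → ℝ) : 0 ≤ u ⬝ᵥ S *ᵥ u := by
  simpa using hS.dotProduct_mulVec_nonneg u

/-- The law of a linear combination of two independent Gaussian vectors. -/
lemma map_dotProduct_add_dotProduct {n m : ℕ} {Ω : Type*} [MeasurableSpace Ω] {P : Measure Ω}
    {X : Ω → (Fin n → ℝ)} {V : Ω → (Fin m → ℝ)} (hX : Measurable X) (hV : Measurable V)
    {μ : Fin n → ℝ} {ν : Fin m → ℝ} {Q : Matrix (Fin n) (Fin n) ℝ} {R : Matrix (Fin m) (Fin m) ℝ}
    (hQ : Q.PosSemidef) (hR : R.PosSemidef)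
    (hXlaw : IsGaussianVec (P.map X) μ Q) (hVlaw : IsGaussianVec (P.map V) ν R)
    (hindep : IndepFun X V P) (a : Fin n → ℝ) (b : Fin m → ℝ) :
    P.map (fun ω => a ⬝ᵥ X ω + b ⬝ᵥ V ω) =
      gaussianReal (a ⬝ᵥ μ + b ⬝ᵥ ν) (a ⬝ᵥ Q *ᵥ a + b ⬝ᵥ R *ᵥ b).toNNReal := by
  have ha : Measurable fun x : Fin n → ℝ => a ⬝ᵥ x := by unfold dotProduct; fun_prop
  have hb : Measurable fun x : Fin m → ℝ => b ⬝ᵥ x := by unfold dotProduct; fun_prop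
  have h1 := hXlaw a
  have h2 := hVlaw b
  rw [Measure.map_map ha hX] at h1
  rw [Measure.map_map hb hV] at h2
  rw [Real.toNNReal_add (quadForm_nonneg hQ a) (quadForm_nonneg hR b)]
  exact gaussianReal_add_gaussianReal_of_indepFun (hindep.comp ha hb) h1 h2

lemma charFunDual_map_of_gaussianReal {E Ω : Type*} [NormedAddCommGroup E] [NormedSpace ℝ E]
    [MeasurableSpace E] [BorelSpace E] [MeasurableSpace Ω] {P : Measure Ω} {Y : Ω → E}
    (hY : Measurable Y) (f : StrongDual ℝ E) {c : ℝ} {v : NNReal}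
    (h : P.map (fun ω => f (Y ω)) = gaussianReal c v) :
    charFunDual (P.map Y) f = Complex.exp (c * Complex.I - v / 2) := by
  rw [charFunDual_eq_charFun_map_one, Measure.map_map f.continuous.measurable hY]
  change charFun (P.map (fun ω => f (Y ω))) 1 = _
  rw [h, charFun_gaussianReal]
  simp

/-- If every linear combination of `W` and `Z` is Gaussian with uncorrelated contributions of
`W` and `Z`, then `W` and `Z` are independent. -/
lemma indepFun_of_map_dotProduct_add {n m : ℕ} {Ω : Type*} [MeasurableSpace Ω] {P : Measure Ω}
    [IsProbabilityMeasure P]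
    {W : Ω → (Fin n → ℝ)} {Z : Ω → (Fin m → ℝ)} (hW : Measurable W) (hZ : Measurable Z)
    {α : Fin n → ℝ} {β : Fin m → ℝ} {Q : Matrix (Fin n) (Fin n) ℝ} {S : Matrix (Fin m) (Fin m) ℝ}
    (hQ : Q.PosSemidef) (hS : S.PosSemidef)
    (h : ∀ u v, P.map (fun ω => u ⬝ᵥ W ω + v ⬝ᵥ Z ω) =
      gaussianReal (u ⬝ᵥ α + v ⬝ᵥ β) (u ⬝ᵥ Q *ᵥ u + v ⬝ᵥ S *ᵥ v).toNNReal) :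
    IndepFun W Z P := by
  rw [indepFun_iff_charFunDual_prod hW.aemeasurable hZ.aemeasurable]
  intro f
  obtain ⟨u, hu⟩ := exists_dotProduct_of_strongDual (f.comp (.inl ℝ _ _))
  obtain ⟨v, hv⟩ := exists_dotProduct_of_strongDual (f.comp (.inr ℝ _ _))
  have hf : ∀ ω, f (W ω, Z ω) = u ⬝ᵥ W ω + v ⬝ᵥ Z ω := fun ω => by
    rw [← hu, ← hv]
    simp [← map_add]
  have hWu := h u 0
  have hZv := h 0 v
  simp only [zero_dotProduct, add_zero, zero_add] at hWu hZv
  rw [charFunDual_map_of_gaussianReal (hW.prodMk hZ) f (by simpa only [hf] using h u v),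
    charFunDual_map_of_gaussianReal hW _ (by simpa only [hu] using hWu),
    charFunDual_map_of_gaussianReal hZ _ (by simpa only [hv] using hZv), ← Complex.exp_add]
  rw [Real.toNNReal_add (quadForm_nonneg hQ u) (quadForm_nonneg hS v)]
  congr 1
  push_cast
  ring

/-- If `W` and `Z` are independent, the conditional distribution of `W + g(Z)` given `Z = z` is
the law of `W` translated by `g z`. -/
lemma condDistrib_add_comp_of_indepFun {n : ℕ} {Ω β : Type*} [MeasurableSpace Ω]
    [MeasurableSpace β] {P : Measure Ω} [IsProbabilityMeasure P]
    {W : Ω → (Fin n → ℝ)} {Z : Ω → β} (hW : Measurable W) (hZ : Measurable Z)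
    (hind : IndepFun Z W P) {g : β → (Fin n → ℝ)} (hg : Measurable g) :
    ∀ᵐ z ∂(P.map Z),
      condDistrib (fun ω => W ω + g (Z ω)) Z P z = (P.map W).map (fun w => w + g z) := by
  have : IsProbabilityMeasure (P.map W) := Measure.isProbabilityMeasure_map hW.aemeasurable
  have : IsProbabilityMeasure (P.map Z) := Measure.isProbabilityMeasure_map hZ.aemeasurable
  have hF : Measurable fun p : β × (Fin n → ℝ) => p.2 + g p.1 := by fun_prop
  let κ : Kernel β (Fin n → ℝ) :=
    (Kernel.id ×ₖ Kernel.const β (P.map W)).map fun p => p.2 + g p.1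
  have hκ : ∀ z, κ z = (P.map W).map (fun w => w + g z) := fun z => by
    simp only [κ]
    rw [Kernel.map_apply _ hF, Kernel.prod_apply, Kernel.id_apply, Kernel.const_apply,
      Measure.dirac_prod, Measure.map_map hF (by fun_prop)]
    rfl
  have : IsMarkovKernel κ := Kernel.IsMarkovKernel.map _ hF
  have key : P.map (fun ω => (Z ω, W ω + g (Z ω))) = P.map Z ⊗ₘ κ := by
    have hG : Measurable fun p : β × (Fin n → ℝ) => (p.1, p.2 + g p.1) := by fun_prop
    have h1 : P.map (fun ω => (Z ω, W ω + g (Z ω))) =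
        ((P.map Z).prod (P.map W)).map fun p => (p.1, p.2 + g p.1) := by
      rw [← (indepFun_iff_map_prod_eq_prod_map_map hZ.aemeasurable hW.aemeasurable).1 hind,
        Measure.map_map hG (hZ.prodMk hW)]
      rfl
    ext s hs
    rw [h1, Measure.map_apply hG hs, Measure.prod_apply (hG hs), Measure.compProd_apply hs]
    refine lintegral_congr fun z => ?_
    rw [hκ, Measure.map_apply (by fun_prop) (measurable_prodMk_left hs)]
    rfl
  have hY : Measurable fun ω => W ω + g (Z ω) := by fun_prop
  filter_upwards [condDistrib_ae_eq_of_measure_eq_compProd Z hY.aemeasurable key] with z hz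
  rw [hz, hκ]

lemma IsGaussianVec.map_add_const {k : ℕ} {ν : Measure (Fin k → ℝ)} {c : Fin k → ℝ}
    {Q : Matrix (Fin k) (Fin k) ℝ} (h : IsGaussianVec ν c Q) (d : Fin k → ℝ) :
    IsGaussianVec (ν.map (fun w => w + d)) (c + d) Q := by
  intro a
  have ha : Measurable fun x : Fin k → ℝ => a ⬝ᵥ x := by unfold dotProduct; fun_prop
  rw [Measure.map_map ha (by fun_prop), dotProduct_add, ← gaussianReal_map_add_const, ← h a,
    Measure.map_map (by fun_prop) ha]
  congr 1
  ext w
  simp [dotProduct_add]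

/-- The covariance of `(X - LZ, Z)` is block diagonal for the Kalman gain `L`. -/
lemma quadForm_kalman {n m : ℕ} {Q : Matrix (Fin n) (Fin n) ℝ} {R S : Matrix (Fin m) (Fin m) ℝ}
    {C : Matrix (Fin m) (Fin n) ℝ} {L : Matrix (Fin n) (Fin m) ℝ}
    (hQ : Qᵀ = Q) (hST : Sᵀ = S) (hS : S = C * Q * Cᵀ + R) (hL : L * S = Q * Cᵀ)
    (u : Fin n → ℝ) (v : Fin m → ℝ) :
    (u + Cᵀ *ᵥ (v - Lᵀ *ᵥ u)) ⬝ᵥ Q *ᵥ (u + Cᵀ *ᵥ (v - Lᵀ *ᵥ u)) +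
        (v - Lᵀ *ᵥ u) ⬝ᵥ R *ᵥ (v - Lᵀ *ᵥ u) =
      u ⬝ᵥ (Q - L * C * Q) *ᵥ u + v ⬝ᵥ S *ᵥ v := by
  have hL' : S * Lᵀ = C * Q := by
    have := congrArg transpose hL
    simpa [transpose_mul, hQ, hST] using this
  have hR : R = S - C * Q * Cᵀ := by rw [hS]; abel
  have e1 : ∀ w, u ⬝ᵥ Q *ᵥ Cᵀ *ᵥ w = (Lᵀ *ᵥ u) ⬝ᵥ S *ᵥ w := fun w => by
    rw [mulVec_mulVec, ← hL, ← mulVec_mulVec, dotProduct_mulVec u L, ← mulVec_transpose]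
  have e2 : ∀ w, (Cᵀ *ᵥ w) ⬝ᵥ Q *ᵥ u = w ⬝ᵥ S *ᵥ Lᵀ *ᵥ u := fun w => by
    rw [mulVec_transpose, ← dotProduct_mulVec, mulVec_mulVec, ← hL', ← mulVec_mulVec]
  have e3 : ∀ w w', (Cᵀ *ᵥ w) ⬝ᵥ Q *ᵥ Cᵀ *ᵥ w' = w ⬝ᵥ (C * Q * Cᵀ) *ᵥ w' := fun w w' => by
    rw [mulVec_transpose C w, ← dotProduct_mulVec, mulVec_mulVec, mulVec_mulVec,
      Matrix.mul_assoc]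
  have e4 : u ⬝ᵥ (L * C * Q) *ᵥ u = (Lᵀ *ᵥ u) ⬝ᵥ S *ᵥ Lᵀ *ᵥ u := by
    rw [Matrix.mul_assoc, ← hL', ← mulVec_mulVec, dotProduct_mulVec u L, ← mulVec_transpose,
      mulVec_mulVec]
  rw [mulVec_add, dotProduct_add, add_dotProduct, add_dotProduct, e1, e2, e3, hR, sub_mulVec,
    sub_mulVec, dotProduct_sub, dotProduct_sub, e4]
  simp only [mulVec_sub, dotProduct_sub, sub_dotProduct]
  ring

end KalmanUpdate

open KalmanUpdate

/-- Kalman measurement update: if `X ~ N(μ, Sx)` and `V ~ N(0, R)` are independent,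
`Z = C·X + V`, `S = C·Sx·Cᵀ + R` is invertible and `L = Sx·Cᵀ·S⁻¹`, then `Sx - L·C·Sx` is
positive semidefinite, and for law(Z)-a.e. `z` the conditional distribution of `X` given
`Z = z` is the Gaussian `N(μ + L·(z - C·μ), Sx - L·C·Sx)`. -/
theorem kalman_measurement_update
    {n m : ℕ} {Ω : Type*} [MeasurableSpace Ω] (P : Measure Ω) [IsProbabilityMeasure P]
    (X : Ω → (Fin n → ℝ)) (V : Ω → (Fin m → ℝ)) (hX : Measurable X) (hV : Measurable V)
    (μ : Fin n → ℝ) (Sx : Matrix (Fin n) (Fin n) ℝ) (R : Matrix (Fin m) (Fin m) ℝ)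
    (hSx : Sx.PosSemidef) (hR : R.PosSemidef)
    (hXlaw : IsGaussianVec (P.map X) μ Sx) (hVlaw : IsGaussianVec (P.map V) 0 R)
    (hindep : IndepFun X V P)
    (C : Matrix (Fin m) (Fin n) ℝ)
    (Z : Ω → (Fin m → ℝ)) (hZ : ∀ ω, Z ω = C.mulVec (X ω) + V ω)
    (S : Matrix (Fin m) (Fin m) ℝ) (hS : S = C * Sx * Cᵀ + R) (hSinv : IsUnit S)
    (L : Matrix (Fin n) (Fin m) ℝ) (hL : L = Sx * Cᵀ * S⁻¹) :
    (Sx - L * C * Sx).PosSemidef ∧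
    ∀ᵐ z ∂(P.map Z),
      IsGaussianVec (condDistrib X Z P z) (μ + L.mulVec (z - C.mulVec μ)) (Sx - L * C * Sx) := by
  have hQT : Sxᵀ = Sx := by simpa using hSx.isHermitian.eq
  have hSpos : S.PosSemidef := by
    rw [hS]
    simpa using (hSx.mul_mul_conjTranspose_same C).add hR
  have hST : Sᵀ = S := by simpa using hSpos.isHermitian.eq
  have hLS : L * S = Sx * Cᵀ := by
    rw [hL, Matrix.mul_assoc, Matrix.nonsing_inv_mul _ ((isUnit_iff_isUnit_det S).1 hSinv),
      Matrix.mul_one]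
  have hquad := quadForm_kalman hQT hST hS hLS
  have hpsd : (Sx - L * C * Sx).PosSemidef := by
    refine .of_dotProduct_mulVec_nonneg ?_ fun u => ?_
    · have hLCS : L * C * Sx = L * S * Lᵀ := by
        have := congrArg transpose hLS
        rw [transpose_mul, transpose_mul, hQT, hST, transpose_transpose] at this
        rw [Matrix.mul_assoc, ← this, Matrix.mul_assoc]
      rw [IsHermitian, conjTranspose_eq_transpose_of_trivial, hLCS]
      simp [transpose_mul, hQT, hST, Matrix.mul_assoc]
    · have h0 := hquad u 0
      simp only [zero_dotProduct, add_zero] at h0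
      rw [star_trivial, ← h0]
      exact add_nonneg (quadForm_nonneg hSx _) (quadForm_nonneg hR _)
  refine ⟨hpsd, ?_⟩
  have hmulVec : ∀ {k l : ℕ} (A : Matrix (Fin k) (Fin l) ℝ), Measurable fun x => A *ᵥ x :=
    fun A => (Continuous.matrix_mulVec continuous_const continuous_id).measurable
  have hZm : Measurable Z := by
    rw [funext hZ]
    exact ((hmulVec C).comp hX).add hV
  have hWm : Measurable fun ω => X ω - L *ᵥ Z ω := hX.sub ((hmulVec L).comp hZm)
  have hjoint : ∀ u v, P.map (fun ω => u ⬝ᵥ (X ω - L *ᵥ Z ω) + v ⬝ᵥ Z ω) =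
      gaussianReal (u ⬝ᵥ (μ - L *ᵥ C *ᵥ μ) + v ⬝ᵥ C *ᵥ μ)
        (u ⬝ᵥ (Sx - L * C * Sx) *ᵥ u + v ⬝ᵥ S *ᵥ v).toNNReal := by
    intro u v
    have hlin : ∀ (x : Fin n → ℝ) (y : Fin m → ℝ),
        u ⬝ᵥ (x - L *ᵥ (C *ᵥ x + y)) + v ⬝ᵥ (C *ᵥ x + y) =
          (u + Cᵀ *ᵥ (v - Lᵀ *ᵥ u)) ⬝ᵥ x + (v - Lᵀ *ᵥ u) ⬝ᵥ y := by
      intro x y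
      simp only [mulVec_transpose, add_dotProduct, sub_dotProduct, dotProduct_sub, dotProduct_add,
        mulVec_add, ← dotProduct_mulVec]
      ring
    have hmean := hlin μ 0
    rw [add_zero] at hmean
    rw [← hquad, hmean,
      ← map_dotProduct_add_dotProduct hX hV hSx hR hXlaw hVlaw hindep]
    simp only [hZ, hlin]
  have hind := indepFun_of_map_dotProduct_add hWm hZm hpsd hSpos hjoint
  have hWlaw : IsGaussianVec (P.map fun ω => X ω - L *ᵥ Z ω) (μ - L *ᵥ C *ᵥ μ)
      (Sx - L * C * Sx) := by
    intro a
    have ha : Measurable fun x : Fin n → ℝ => a ⬝ᵥ x := by unfold dotProduct; fun_prop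
    rw [Measure.map_map ha hWm]
    simpa [Function.comp_def] using hjoint a 0
  have hcond := condDistrib_add_comp_of_indepFun hWm hZm hind.symm (hmulVec L)
  simp only [sub_add_cancel] at hcond
  filter_upwards [hcond] with z hz
  rw [hz, mulVec_sub, show μ + (L *ᵥ z - L *ᵥ C *ᵥ μ) = μ - L *ᵥ C *ᵥ μ + L *ᵥ z by abel]
  exact hWlaw.map_add_const _
end

section
/- Let X be a random vector in ℝⁿ with law N(μ, Σ), V a random vector in ℝᵐ with law N(0, R), and W a random vector in ℝⁿ with law N(0, Q), with Σ, R, Q positive semidefinite and X, V, W mutually independent. Let C be a real m×n matrix, A a real n×n matrix, and g : ℝᵐ → ℝⁿ a measurable function. Define the measurement Z = C·X + V and assume S = C·Σ·Cᵀ + R is invertible; set L = Σ·Cᵀ·S⁻¹. Then for (law of Z)-almost every z ∈ ℝᵐ, the conditional distribution of the random vector A·X + g(Z) + W given Z = z is the Gaussian measure with mean A·(μ + L·(z − C·μ)) + g(z) and covariance A·(Σ − L·C·Σ)·Aᵀ + Q, and this covariance matrix is positive semidefinite. -/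
open MeasureTheory ProbabilityTheory Matrix

/-- If `U` is independent of `Z`, then the conditional law of `U + h(Z)` given `Z = z` is the law
of `U` translated by `h z`. -/
lemma condDistrib_add_comp_of_indepFun {Ω β E : Type*} [MeasurableSpace Ω] [MeasurableSpace β]
    [MeasurableSpace E] [StandardBorelSpace E] [Nonempty E] [Add E] [MeasurableAdd₂ E]
    {P : Measure Ω} [IsProbabilityMeasure P] {U : Ω → E} {Z : Ω → β} {h : β → E}
    (hU : Measurable U) (hZ : Measurable Z) (hh : Measurable h) (hUZ : IndepFun U Z P) :
    ∀ᵐ z ∂(P.map Z), condDistrib (fun ω => U ω + h (Z ω)) Z P z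
      = (P.map U).map (fun u => u + h z) := by
  have hadd : Measurable fun p : β × E => p.2 + h p.1 := by fun_prop
  have : IsProbabilityMeasure (P.map U) := Measure.isProbabilityMeasure_map hU.aemeasurable
  let κ : Kernel β E := (Kernel.id ×ₖ Kernel.const β (P.map U)).map fun p => p.2 + h p.1
  have hκ (z : β) : κ z = (P.map U).map fun u => u + h z := by
    simp only [κ, Kernel.map_apply _ hadd, Kernel.prod_apply, Kernel.id_apply, Kernel.const_apply]
    rw [Measure.dirac_prod, Measure.map_map hadd (by fun_prop)]
    rfl
  have hκm : IsMarkovKernel κ := Kernel.IsMarkovKernel.map _ hadd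
  have hae : condDistrib (fun ω => U ω + h (Z ω)) Z P =ᵐ[P.map Z] κ := by
    refine condDistrib_ae_eq_of_measure_eq_compProd Z (by fun_prop) ?_
    have hcomp : P.map (fun ω => (Z ω, U ω + h (Z ω)))
        = ((P.map Z).prod (P.map U)).map (fun p => (p.1, p.2 + h p.1)) := by
      rw [← hUZ.symm.map_prod_eq_prod_map_map hZ.aemeasurable hU.aemeasurable,
        Measure.map_map (by fun_prop) (by fun_prop)]
      rfl
    have : IsProbabilityMeasure (P.map Z) := Measure.isProbabilityMeasure_map hZ.aemeasurable
    ext s hs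
    rw [hcomp, Measure.map_apply (by fun_prop) hs, Measure.compProd_apply hs,
      Measure.prod_apply ((show Measurable fun p : β × E => (p.1, p.2 + h p.1) by fun_prop) hs)]
    refine lintegral_congr fun z => ?_
    rw [hκ, Measure.map_apply (by fun_prop) (measurable_prodMk_left hs)]
    rfl
  filter_upwards [hae] with z hz
  rw [hz, hκ]

/-- Two random vectors are independent as soon as each linear combination of their coordinates is
Gaussian with the mean and variance it would have under independence. -/
lemma indepFun_of_map_dotProduct_add_eq_gaussianReal {Ω : Type*} [MeasurableSpace Ω]
    {n m : ℕ} {P : Measure Ω} [IsProbabilityMeasure P] {U : Ω → Fin n → ℝ} {Z : Ω → Fin m → ℝ}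
    (hU : Measurable U) (hZ : Measurable Z) {μU : Fin n → ℝ} {μZ : Fin m → ℝ}
    {T : Matrix (Fin n) (Fin n) ℝ} {S : Matrix (Fin m) (Fin m) ℝ}
    (h : ∀ a b, P.map (fun ω => a ⬝ᵥ U ω + b ⬝ᵥ Z ω) = gaussianReal (a ⬝ᵥ μU + b ⬝ᵥ μZ)
      (Real.toNNReal (a ⬝ᵥ T *ᵥ a) + Real.toNNReal (b ⬝ᵥ S *ᵥ b))) :
    IndepFun U Z P := by
  rw [indepFun_iff_charFunDual_prod hU.aemeasurable hZ.aemeasurable]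
  intro L
  have hdual {k : ℕ} (ℓ : StrongDual ℝ (Fin k → ℝ)) : ∃ a, ∀ x, ℓ x = a ⬝ᵥ x := by
    refine ⟨(dotProductEquiv ℝ (Fin k)).symm ℓ.toLinearMap, fun x => ?_⟩
    exact (LinearMap.congr_fun ((dotProductEquiv ℝ (Fin k)).apply_symm_apply ℓ.toLinearMap) x).symm
  obtain ⟨a, ha⟩ := hdual (L.comp (.inl ℝ _ _))
  obtain ⟨b, hb⟩ := hdual (L.comp (.inr ℝ _ _))
  have hL (x : Fin n → ℝ) (y : Fin m → ℝ) : L (x, y) = a ⬝ᵥ x + b ⬝ᵥ y := by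
    rw [← ha, ← hb]
    simp [← map_add]
  simp only [charFunDual_eq_charFun_map_one]
  rw [Measure.map_map (by fun_prop) (by fun_prop), Measure.map_map (by fun_prop) hU,
    Measure.map_map (by fun_prop) hZ]
  have h1 : ⇑L ∘ (fun ω => (U ω, Z ω)) = fun ω => a ⬝ᵥ U ω + b ⬝ᵥ Z ω := by
    ext ω; exact hL _ _
  have h2 : ⇑(L.comp (.inl ℝ _ _)) ∘ U = fun ω => a ⬝ᵥ U ω + 0 ⬝ᵥ Z ω := by
    ext ω; simpa using ha (U ω)
  have h3 : ⇑(L.comp (.inr ℝ _ _)) ∘ Z = fun ω => 0 ⬝ᵥ U ω + b ⬝ᵥ Z ω := by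
    ext ω; simpa using hb (Z ω)
  rw [h1, h2, h3, h, h, h]
  simp only [charFun_gaussianReal, ← Complex.exp_add]
  congr 1
  simp
  ring

/-- A sum of linear functionals of three independent Gaussian vectors is Gaussian. -/
lemma map_dotProduct_add_three_eq_gaussianReal {Ω : Type*} [MeasurableSpace Ω] {n m k : ℕ}
    {P : Measure Ω} {X : Ω → Fin n → ℝ} {V : Ω → Fin m → ℝ} {W : Ω → Fin k → ℝ}
    (hX : Measurable X) (hV : Measurable V) (hW : Measurable W)
    {μX : Fin n → ℝ} {μV : Fin m → ℝ} {μW : Fin k → ℝ} {SX : Matrix (Fin n) (Fin n) ℝ}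
    {SV : Matrix (Fin m) (Fin m) ℝ} {SW : Matrix (Fin k) (Fin k) ℝ}
    (hSX : SX.PosSemidef) (hSV : SV.PosSemidef) (hSW : SW.PosSemidef)
    (hXlaw : IsGaussianVec (P.map X) μX SX) (hVlaw : IsGaussianVec (P.map V) μV SV)
    (hWlaw : IsGaussianVec (P.map W) μW SW)
    (hindep : iIndep
      ![MeasurableSpace.comap X inferInstance, MeasurableSpace.comap V inferInstance,
        MeasurableSpace.comap W inferInstance] P)
    (p : Fin n → ℝ) (q : Fin m → ℝ) (r : Fin k → ℝ) :
    P.map (fun ω => p ⬝ᵥ X ω + q ⬝ᵥ V ω + r ⬝ᵥ W ω) =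
      gaussianReal (p ⬝ᵥ μX + q ⬝ᵥ μV + r ⬝ᵥ μW)
        (Real.toNNReal (p ⬝ᵥ SX *ᵥ p + q ⬝ᵥ SV *ᵥ q + r ⬝ᵥ SW *ᵥ r)) := by
  have hXV : IndepFun X V P := hindep.indep (i := 0) (j := 1) (by decide)
  have hXVW : IndepFun (fun ω => (X ω, V ω)) W P := by
    have hle : ∀ i, (![MeasurableSpace.comap X inferInstance,
        MeasurableSpace.comap V inferInstance, MeasurableSpace.comap W inferInstance] i) ≤
        (inferInstance : MeasurableSpace Ω) := by
      intro i
      fin_cases i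
      exacts [hX.comap_le, hV.comap_le, hW.comap_le]
    have := indep_iSup_of_disjoint hle hindep (S := {0, 1}) (T := {2}) (by simp)
    rw [iSup_pair, iSup_singleton] at this
    rw [IndepFun_iff_Indep]
    exact (congrArg (Indep · _ P) (MeasurableSpace.comap_prodMk X V)).mpr this
  have h1 := hXV.comp (φ := fun x => p ⬝ᵥ x) (ψ := fun x => q ⬝ᵥ x) (by fun_prop) (by fun_prop)
  have h2 := hXVW.comp (φ := fun x => p ⬝ᵥ x.1 + q ⬝ᵥ x.2) (ψ := fun x => r ⬝ᵥ x)
    (by fun_prop) (by fun_prop)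
  have gX := hXlaw p
  have gV := hVlaw q
  have gW := hWlaw r
  rw [Measure.map_map (by fun_prop) (by assumption)] at gX gV gW
  have h3 := gaussianReal_add_gaussianReal_of_indepFun h2
    (gaussianReal_add_gaussianReal_of_indepFun h1 gX gV) gW
  have nX : 0 ≤ p ⬝ᵥ SX *ᵥ p := hSX.dotProduct_mulVec_nonneg p
  have nV : 0 ≤ q ⬝ᵥ SV *ᵥ q := hSV.dotProduct_mulVec_nonneg q
  have nW : 0 ≤ r ⬝ᵥ SW *ᵥ r := hSW.dotProduct_mulVec_nonneg r
  rw [Real.toNNReal_add (add_nonneg nX nV) nW, Real.toNNReal_add nX nV]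
  exact h3

/-- Joseph form of the filtered covariance. -/
lemma kalman_covariance_eq_joseph {n m : ℕ} {Sx : Matrix (Fin n) (Fin n) ℝ}
    {R : Matrix (Fin m) (Fin m) ℝ} {C : Matrix (Fin m) (Fin n) ℝ} {L : Matrix (Fin n) (Fin m) ℝ}
    (hL : L * (C * Sx * Cᵀ + R) = Sx * Cᵀ) :
    Sx - L * C * Sx = (1 - L * C) * Sx * (1 - L * C)ᵀ + L * R * Lᵀ := by
  have hLR : L * R = Sx * Cᵀ - L * (C * Sx * Cᵀ) := by
    rw [← hL, Matrix.mul_add]; abel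
  rw [hLR]
  simp only [transpose_sub, transpose_one, transpose_mul, Matrix.sub_mul, Matrix.mul_sub,
    Matrix.one_mul, Matrix.mul_one, Matrix.mul_assoc]
  abel

lemma transpose_mulVec_dotProduct_mulVec_transpose_mulVec {k l j i : ℕ}
    (M : Matrix (Fin k) (Fin l) ℝ) (N : Matrix (Fin l) (Fin j) ℝ) (K : Matrix (Fin i) (Fin j) ℝ)
    (a : Fin k → ℝ) (b : Fin i → ℝ) :
    (Mᵀ *ᵥ a) ⬝ᵥ N *ᵥ (Kᵀ *ᵥ b) = a ⬝ᵥ (M * N * Kᵀ) *ᵥ b := by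
  rw [mulVec_transpose, ← dotProduct_mulVec, mulVec_mulVec, mulVec_mulVec, Matrix.mul_assoc]

/-- The quadratic form of the covariance of `(K₁ X - K₂ V, C X + V)` splits when the
cross-covariance vanishes. -/
lemma quadForm_add_eq_of_cross_eq {k n m : ℕ} {Sx : Matrix (Fin n) (Fin n) ℝ}
    {R : Matrix (Fin m) (Fin m) ℝ} (hSx : Sxᵀ = Sx) (hR : Rᵀ = R) {C : Matrix (Fin m) (Fin n) ℝ}
    {K₁ : Matrix (Fin k) (Fin n) ℝ} {K₂ : Matrix (Fin k) (Fin m) ℝ}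
    (hcross : K₁ * Sx * Cᵀ = K₂ * R) (a : Fin k → ℝ) (b : Fin m → ℝ) :
    (K₁ᵀ *ᵥ a + Cᵀ *ᵥ b) ⬝ᵥ Sx *ᵥ (K₁ᵀ *ᵥ a + Cᵀ *ᵥ b)
        + (b - K₂ᵀ *ᵥ a) ⬝ᵥ R *ᵥ (b - K₂ᵀ *ᵥ a)
      = a ⬝ᵥ (K₁ * Sx * K₁ᵀ + K₂ * R * K₂ᵀ) *ᵥ a + b ⬝ᵥ (C * Sx * Cᵀ + R) *ᵥ b := by
  have hcross' : C * Sx * K₁ᵀ = R * K₂ᵀ := by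
    have := congrArg transpose hcross
    simpa only [transpose_mul, transpose_transpose, hSx, hR, Matrix.mul_assoc] using this
  have h1 : (K₂ᵀ *ᵥ a) ⬝ᵥ R *ᵥ b = a ⬝ᵥ (K₂ * R) *ᵥ b := by
    rw [mulVec_transpose, ← dotProduct_mulVec, mulVec_mulVec]
  have h2 : b ⬝ᵥ R *ᵥ (K₂ᵀ *ᵥ a) = b ⬝ᵥ (R * K₂ᵀ) *ᵥ a := by rw [mulVec_mulVec]
  simp only [mulVec_add, mulVec_sub, dotProduct_add, add_dotProduct, sub_dotProduct,
    dotProduct_sub, add_mulVec, transpose_mulVec_dotProduct_mulVec_transpose_mulVec, h1, h2,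
    hcross, hcross']
  ring

/-- Delayed (skip-step) Kalman update: with `X ~ N(μ, Sx)`, `V ~ N(0, R)`, `W ~ N(0, Q)`
mutually independent, measurement `Z = C·X + V`, invertible innovation `S = C·Sx·Cᵀ + R`,
gain `L = Sx·Cᵀ·S⁻¹`, and a measurable control term `g`, for law(Z)-a.e. `z` the conditional
distribution of `A·X + g(Z) + W` given `Z = z` is Gaussian with mean
`A·(μ + L·(z - C·μ)) + g(z)` and positive semidefinite covariance `A·(Sx - L·C·Sx)·Aᵀ + Q`. -/
theorem kalman_skip_step_update
    {n m : ℕ} {Ω : Type*} [MeasurableSpace Ω] (P : Measure Ω) [IsProbabilityMeasure P]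
    (X : Ω → (Fin n → ℝ)) (V : Ω → (Fin m → ℝ)) (W : Ω → (Fin n → ℝ))
    (hX : Measurable X) (hV : Measurable V) (hW : Measurable W)
    (μ : Fin n → ℝ) (Sx Q : Matrix (Fin n) (Fin n) ℝ) (R : Matrix (Fin m) (Fin m) ℝ)
    (hSx : Sx.PosSemidef) (hR : R.PosSemidef) (hQ : Q.PosSemidef)
    (hXlaw : IsGaussianVec (P.map X) μ Sx)
    (hVlaw : IsGaussianVec (P.map V) 0 R)
    (hWlaw : IsGaussianVec (P.map W) 0 Q)
    (hindep : iIndep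
      ![MeasurableSpace.comap X inferInstance, MeasurableSpace.comap V inferInstance,
        MeasurableSpace.comap W inferInstance] P)
    (C : Matrix (Fin m) (Fin n) ℝ) (A : Matrix (Fin n) (Fin n) ℝ)
    (g : (Fin m → ℝ) → (Fin n → ℝ)) (hg : Measurable g)
    (Z : Ω → (Fin m → ℝ)) (hZ : ∀ ω, Z ω = C.mulVec (X ω) + V ω)
    (S : Matrix (Fin m) (Fin m) ℝ) (hS : S = C * Sx * Cᵀ + R) (hSinv : IsUnit S)
    (L : Matrix (Fin n) (Fin m) ℝ) (hL : L = Sx * Cᵀ * S⁻¹) :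
    (A * (Sx - L * C * Sx) * Aᵀ + Q).PosSemidef ∧
    ∀ᵐ z ∂(P.map Z),
      IsGaussianVec (condDistrib (fun ω => A.mulVec (X ω) + g (Z ω) + W ω) Z P z)
        (A.mulVec (μ + L.mulVec (z - C.mulVec μ)) + g z)
        (A * (Sx - L * C * Sx) * Aᵀ + Q) := by
  have hST : Sxᵀ = Sx := hSx.isHermitian.eq
  have hRT : Rᵀ = R := hR.isHermitian.eq
  have hLS : L * (C * Sx * Cᵀ + R) = Sx * Cᵀ := by
    rw [hL, ← hS, Matrix.mul_assoc, nonsing_inv_mul _ ((isUnit_iff_isUnit_det S).1 hSinv),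
      Matrix.mul_one]
  have hjoseph := kalman_covariance_eq_joseph hLS
  have hpsd : (A * (Sx - L * C * Sx) * Aᵀ + Q).PosSemidef := by
    rw [hjoseph]
    exact (((hSx.mul_mul_conjTranspose_same _).add
      (hR.mul_mul_conjTranspose_same L)).mul_mul_conjTranspose_same A).add hQ
  have hSpsd : S.PosSemidef := hS ▸ (hSx.mul_mul_conjTranspose_same C).add hR
  refine ⟨hpsd, ?_⟩
  have hZfun : Z = fun ω => C *ᵥ X ω + V ω := funext hZ
  have hZm : Measurable Z := by
    rw [hZfun]; fun_prop
  set T := A * (Sx - L * C * Sx) * Aᵀ + Q with hT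
  set G := A * (1 - L * C) with hG
  set U : Ω → Fin n → ℝ := fun ω => G *ᵥ X ω - (A * L) *ᵥ V ω + W ω with hU
  have hUm : Measurable U := by fun_prop
  have hcross : G * Sx * Cᵀ = A * L * R := by
    have : L * R = Sx * Cᵀ - L * (C * Sx * Cᵀ) := by
      rw [← hLS, Matrix.mul_add]; abel
    rw [Matrix.mul_assoc A L R, this, hG]
    simp only [Matrix.mul_sub, Matrix.sub_mul, Matrix.mul_one, Matrix.mul_assoc]
  have hTG : T = G * Sx * Gᵀ + A * L * R * (A * L)ᵀ + Q := by
    rw [hT, hjoseph, hG]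
    simp only [transpose_mul, Matrix.mul_add, Matrix.add_mul, Matrix.mul_assoc]
  have hjoint (a : Fin n → ℝ) (b : Fin m → ℝ) :
      P.map (fun ω => a ⬝ᵥ U ω + b ⬝ᵥ Z ω) = gaussianReal (a ⬝ᵥ G *ᵥ μ + b ⬝ᵥ C *ᵥ μ)
        (Real.toNNReal (a ⬝ᵥ T *ᵥ a) + Real.toNNReal (b ⬝ᵥ S *ᵥ b)) := by
    have h := map_dotProduct_add_three_eq_gaussianReal hX hV hW hSx hR hQ hXlaw hVlaw hWlaw hindep
      (Gᵀ *ᵥ a + Cᵀ *ᵥ b) (b - (A * L)ᵀ *ᵥ a) a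
    rw [quadForm_add_eq_of_cross_eq hST hRT hcross, ← hS, add_right_comm (_ ⬝ᵥ _ *ᵥ a),
      ← dotProduct_add, ← add_mulVec, ← hTG] at h
    have nT : 0 ≤ a ⬝ᵥ T *ᵥ a := hpsd.dotProduct_mulVec_nonneg a
    have nS : 0 ≤ b ⬝ᵥ S *ᵥ b := hSpsd.dotProduct_mulVec_nonneg b
    rw [← Real.toNNReal_add nT nS]
    simp only [add_dotProduct, sub_dotProduct, mulVec_transpose, ← dotProduct_mulVec,
      dotProduct_zero, add_zero] at h
    rw [← h]
    congr 1
    ext ω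
    simp only [hU, hZ, dotProduct_add, dotProduct_sub]
    ring
  have hind : IndepFun U Z P := indepFun_of_map_dotProduct_add_eq_gaussianReal hUm hZm hjoint
  have hdecomp : (fun ω => A *ᵥ X ω + g (Z ω) + W ω)
      = fun ω => U ω + ((A * L) *ᵥ Z ω + g (Z ω)) := by
    ext1 ω
    simp only [hU, hZ, hG, Matrix.mul_sub, Matrix.mul_one, sub_mulVec, mulVec_add, mulVec_mulVec,
      Matrix.mul_assoc]
    abel
  rw [hdecomp]
  filter_upwards [condDistrib_add_comp_of_indepFun (h := fun z => (A * L) *ᵥ z + g z) hUm hZm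
    (by fun_prop) hind] with z hz
  intro a
  have ha := hjoint a 0
  simp only [zero_dotProduct, add_zero, Real.toNNReal_zero] at ha
  rw [hz, Measure.map_map (by fun_prop) (by fun_prop), Measure.map_map (by fun_prop) hUm]
  have hcomp : ((fun x => a ⬝ᵥ x) ∘ fun u => u + ((A * L) *ᵥ z + g z)) ∘ U
      = (fun x => x + a ⬝ᵥ ((A * L) *ᵥ z + g z)) ∘ fun ω => a ⬝ᵥ U ω := by
    ext ω; simp [dotProduct_add]
  rw [hcomp, ← Measure.map_map (by fun_prop) (by fun_prop), ha, gaussianReal_map_add_const]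
  congr 1
  rw [← dotProduct_add]
  congr 1
  simp only [hG, Matrix.mul_sub, Matrix.mul_one, sub_mulVec, mulVec_add, mulVec_sub, mulVec_mulVec]
  abel
end
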